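/- Let g and ḡ be projectively equivalent metrics on U, and for t ∈ ℝ define I_t : U × ℝⁿ → ℝ by I_t(x,p) := pᵀ S(t)(x) g(x)⁻¹ p. Then for all t, s ∈ ℝ the functions I_t and I_s Poisson-commute: Σ_{i=1}^{n} (∂I_t/∂p_i · ∂I_s/∂x^i − ∂I_t/∂x^i · ∂I_s/∂p_i) = 0 identically on U × ℝⁿ. -/

import Mathlib

open Matrix

noncomputable section

/-- Partial derivative in the `i`-th coordinate direction of a real-valued function on `ℝⁿ`. -/
def pd {n : ℕ} (i : Fin n) (f : (Fin n → ℝ) → ℝ) : (Fin n → ℝ) → ℝ :=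
  fun x => fderiv ℝ f x (Pi.single i 1)

/-- Iterated partial derivatives along a list of coordinate directions. -/
def iterPD {n : ℕ} : List (Fin n) → ((Fin n → ℝ) → ℝ) → ((Fin n → ℝ) → ℝ)
  | [], f => f
  | i :: l, f => pd i (iterPD l f)

/-- `g` is a (pseudo-Riemannian) metric on `U`: a smooth field of invertible symmetric
real `n×n` matrices. -/
structure IsMetricOn {n : ℕ} (U : Set (Fin n → ℝ))
    (g : (Fin n → ℝ) → Matrix (Fin n) (Fin n) ℝ) : Prop where
  smooth : ∀ i j : Fin n, ContDiffOn ℝ (⊤ : ℕ∞) (fun x => g x i j) U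
  symm : ∀ x ∈ U, (g x).IsSymm
  nondeg : ∀ x ∈ U, IsUnit (g x).det

/-- The Christoffel symbols `Γ^k_{ij}` of the metric `g`. -/
def Gamma {n : ℕ} (g : (Fin n → ℝ) → Matrix (Fin n) (Fin n) ℝ)
    (k i j : Fin n) (x : Fin n → ℝ) : ℝ :=
  (1/2) * ∑ ℓ, (g x)⁻¹ k ℓ *
    (pd i (fun y => g y ℓ j) x + pd j (fun y => g y ℓ i) x - pd ℓ (fun y => g y i j) x)

/-- An open interval of `ℝ` (possibly empty or unbounded): an open order-connected set. -/
def IsOpenInterval (I : Set ℝ) : Prop := IsOpen I ∧ I.OrdConnected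

/-- `γ` is a `g`-geodesic defined on the open interval `I`, with values in `U`. -/
structure IsGeodesicOn {n : ℕ} (U : Set (Fin n → ℝ))
    (g : (Fin n → ℝ) → Matrix (Fin n) (Fin n) ℝ)
    (γ : ℝ → (Fin n → ℝ)) (I : Set ℝ) : Prop where
  interval : IsOpenInterval I
  smooth : ∀ k : Fin n, ContDiffOn ℝ (⊤ : ℕ∞) (fun s => γ s k) I
  mem : ∀ t ∈ I, γ t ∈ U
  eqn : ∀ t ∈ I, ∀ k : Fin n,
    deriv (deriv fun s => γ s k) t
      + ∑ i, ∑ j, Gamma g k i j (γ t) * deriv (fun s => γ s i) t * deriv (fun s => γ s j) t = 0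

/-- `g` and `gbar` are projectively equivalent on `U`: every `g`-geodesic with nowhere
vanishing velocity becomes, after a smooth reparameterization (a diffeomorphism of open
intervals), a `gbar`-geodesic. -/
def ProjEquiv {n : ℕ} (U : Set (Fin n → ℝ))
    (g gbar : (Fin n → ℝ) → Matrix (Fin n) (Fin n) ℝ) : Prop :=
  ∀ (γ : ℝ → (Fin n → ℝ)) (I : Set ℝ), IsGeodesicOn U g γ I →
    (∀ t ∈ I, ∃ k, deriv (fun s => γ s k) t ≠ 0) →
    ∃ (φ : ℝ → ℝ) (J : Set ℝ), IsOpenInterval J ∧ ContDiffOn ℝ (⊤ : ℕ∞) φ J ∧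
      Set.InjOn φ J ∧ φ '' J = I ∧ (∀ t ∈ J, deriv φ t ≠ 0) ∧
      IsGeodesicOn U gbar (γ ∘ φ) J

/-- The (1,1)-tensor `L = |det gbar / det g|^{1/(n+1)} gbar⁻¹ g` built from `g` and `gbar`. -/
def Lfield {n : ℕ} (g gbar : (Fin n → ℝ) → Matrix (Fin n) (Fin n) ℝ)
    (x : Fin n → ℝ) : Matrix (Fin n) (Fin n) ℝ :=
  |(gbar x).det / (g x).det| ^ ((1 : ℝ)/((n : ℝ)+1)) • ((gbar x)⁻¹ * g x)

/-- The family `S(t) = adjugate (t·Id − L)`. -/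
def Sfield {n : ℕ} (g gbar : (Fin n → ℝ) → Matrix (Fin n) (Fin n) ℝ) (t : ℝ)
    (x : Fin n → ℝ) : Matrix (Fin n) (Fin n) ℝ :=
  (t • (1 : Matrix (Fin n) (Fin n) ℝ) - Lfield g gbar x).adjugate

/-- The second order operator associated (via Carter's quantization) to a field `A` of
symmetric matrices: `Â f = |det g|^{-1/2} ∑ᵢⱼ ∂ᵢ(|det g|^{1/2} Aⁱʲ ∂ⱼ f)`. -/
def assocOp {n : ℕ} (g A : (Fin n → ℝ) → Matrix (Fin n) (Fin n) ℝ)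
    (f : (Fin n → ℝ) → ℝ) (x : Fin n → ℝ) : ℝ :=
  |(g x).det| ^ (-(1 : ℝ)/2) * ∑ i, ∑ j,
    pd i (fun y => |(g y).det| ^ ((1 : ℝ)/2) * A y i j * pd j f y) x

/-- The operator `K̂^{(t)}`, associated to `A = S(t)·g⁻¹`. -/
def Khat {n : ℕ} (g gbar : (Fin n → ℝ) → Matrix (Fin n) (Fin n) ℝ) (t : ℝ)
    (f : (Fin n → ℝ) → ℝ) (x : Fin n → ℝ) : ℝ :=
  assocOp g (fun y => Sfield g gbar t y * (g y)⁻¹) f x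

/-- The Beltrami-Laplace operator of `g`, associated to `A = g⁻¹`. -/
def LaplaceOp {n : ℕ} (g : (Fin n → ℝ) → Matrix (Fin n) (Fin n) ℝ)
    (f : (Fin n → ℝ) → ℝ) (x : Fin n → ℝ) : ℝ :=
  assocOp g (fun y => (g y)⁻¹) f x

/-- `K` is a Killing tensor for `g` on `U`: the associated quadratic function is constant
along every `g`-geodesic. -/
def IsKillingTensorOn {n : ℕ} (U : Set (Fin n → ℝ))
    (g K : (Fin n → ℝ) → Matrix (Fin n) (Fin n) ℝ) : Prop :=
  ∀ (γ : ℝ → (Fin n → ℝ)) (I : Set ℝ), IsGeodesicOn U g γ I →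
    ∀ τ₁ ∈ I, ∀ τ₂ ∈ I,
      (∑ i, ∑ j, deriv (fun s => γ s i) τ₁ * K (γ τ₁) i j * deriv (fun s => γ s j) τ₁) =
      (∑ i, ∑ j, deriv (fun s => γ s i) τ₂ * K (γ τ₂) i j * deriv (fun s => γ s j) τ₂)

/-- The covariant derivative `∇_k T_{ij}` of a (0,2)-tensor field `T`. -/
def covDeriv2 {n : ℕ} (g T : (Fin n → ℝ) → Matrix (Fin n) (Fin n) ℝ)
    (k i j : Fin n) (x : Fin n → ℝ) : ℝ :=
  pd k (fun y => T y i j) x - (∑ s, Gamma g s k i x * T x s j)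
    - ∑ s, Gamma g s k j x * T x i s

/-- The Ricci curvature tensor `R_{ij}` of `g`. -/
def Ricci {n : ℕ} (g : (Fin n → ℝ) → Matrix (Fin n) (Fin n) ℝ)
    (i j : Fin n) (x : Fin n → ℝ) : ℝ :=
  (∑ ℓ, pd ℓ (fun y => Gamma g ℓ i j y) x) - (∑ ℓ, pd i (fun y => Gamma g ℓ ℓ j y) x)
    + ∑ ℓ, ∑ s, (Gamma g ℓ ℓ s x * Gamma g s i j x - Gamma g ℓ i s x * Gamma g s ℓ j x)

/-- A function vanishes up to order `k` at `p`: it and all its partial derivatives of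
order `≤ k` vanish at `p`. -/
def VanishUpTo {n : ℕ} (k : ℕ) (f : (Fin n → ℝ) → ℝ) (p : Fin n → ℝ) : Prop :=
  ∀ l : List (Fin n), l.length ≤ k → iterPD l f p = 0


/-- The plain (flat) second order operator `Â f = ∑ᵢⱼ ∂ᵢ(Aⁱʲ ∂ⱼ f)` associated to a
matrix field `A`. -/
def opPlain {n : ℕ} (A : (Fin n → ℝ) → Matrix (Fin n) (Fin n) ℝ)
    (f : (Fin n → ℝ) → ℝ) (x : Fin n → ℝ) : ℝ :=
  ∑ i, ∑ j, pd i (fun y => A y i j * pd j f y) x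

end

section MatrixCalculus

variable {n : ℕ}

theorem Matrix.det_updateCol_eq_adjugate_mulVec (M : Matrix (Fin n) (Fin n) ℝ) (j : Fin n)
    (v : Fin n → ℝ) : (M.updateCol j v).det = (M.adjugate *ᵥ v) j := by
  rw [← cramer_apply, cramer_eq_adjugate_mulVec]

/-- Jacobi's formula for the derivative of a determinant. -/
theorem hasDerivAt_det {M : ℝ → Matrix (Fin n) (Fin n) ℝ} {M' : Matrix (Fin n) (Fin n) ℝ} {t : ℝ}
    (h : ∀ i j, HasDerivAt (fun r => M r i j) (M' i j) t) :
    HasDerivAt (fun r => (M r).det) ((M t).adjugate * M').trace t := by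
  have hd : HasDerivAt (fun r => ∑ σ : Equiv.Perm (Fin n),
      ((Equiv.Perm.sign σ : ℤ) : ℝ) * ∏ i, M r (σ i) i)
      (∑ σ : Equiv.Perm (Fin n), ((Equiv.Perm.sign σ : ℤ) : ℝ) *
        ∑ j, (∏ i ∈ Finset.univ.erase j, M t (σ i) i) • M' (σ j) j) t := by
    refine HasDerivAt.fun_sum fun σ _ => ?_
    exact (HasDerivAt.fun_finsetProd fun i _ => h (σ i) i).const_mul _
  have he : (fun r => (M r).det) = fun r => ∑ σ : Equiv.Perm (Fin n),
      ((Equiv.Perm.sign σ : ℤ) : ℝ) * ∏ i, M r (σ i) i := by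
    funext r
    rw [det_apply']
  rw [he]
  convert hd using 1
  have hj : ∀ j, ((M t).adjugate * M') j j = ((M t).updateCol j fun i => M' i j).det := by
    intro j
    rw [det_updateCol_eq_adjugate_mulVec]
    rfl
  simp only [trace, diag_apply, hj, det_apply', Finset.mul_sum]
  rw [Finset.sum_comm]
  refine Finset.sum_congr rfl fun σ _ => Finset.sum_congr rfl fun j _ => ?_
  rw [← Finset.mul_prod_erase Finset.univ _ (Finset.mem_univ j)]
  have : ∏ i ∈ Finset.univ.erase j, (M t).updateCol j (fun i => M' i j) (σ i) i
      = ∏ i ∈ Finset.univ.erase j, M t (σ i) i := by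
    refine Finset.prod_congr rfl fun i hi => ?_
    rw [updateCol_ne (Finset.ne_of_mem_erase hi)]
  rw [this, updateCol_self, smul_eq_mul]
  ring

theorem hasDerivAt_matrix_mul {M N : ℝ → Matrix (Fin n) (Fin n) ℝ}
    {M' N' : Matrix (Fin n) (Fin n) ℝ} {t : ℝ}
    (hM : ∀ i j, HasDerivAt (fun r => M r i j) (M' i j) t)
    (hN : ∀ i j, HasDerivAt (fun r => N r i j) (N' i j) t) (i j : Fin n) :
    HasDerivAt (fun r => (M r * N r) i j) ((M' * N t + M t * N') i j) t := by
  simp only [mul_apply, Matrix.add_apply, ← Finset.sum_add_distrib]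
  exact HasDerivAt.fun_sum fun k _ => (hM i k).fun_mul (hN k j)

theorem deriv_inv_eq {M : ℝ → Matrix (Fin n) (Fin n) ℝ} {M' G' : Matrix (Fin n) (Fin n) ℝ} {t : ℝ}
    (hM : ∀ i j, HasDerivAt (fun r => M r i j) (M' i j) t)
    (hG : ∀ i j, HasDerivAt (fun r => (M r)⁻¹ i j) (G' i j) t)
    (hu : ∀ᶠ r in nhds t, IsUnit (M r).det) : G' = -((M t)⁻¹ * M' * (M t)⁻¹) := by
  have h0 : G' * M t + (M t)⁻¹ * M' = 0 := by
    ext i j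
    refine (hasDerivAt_matrix_mul hG hM i j).unique ?_
    refine (hasDerivAt_const t ((1 : Matrix (Fin n) (Fin n) ℝ) i j)).congr_of_eventuallyEq ?_
    filter_upwards [hu] with r hr
    rw [nonsing_inv_mul _ hr]
  have h1 : (M t) * (M t)⁻¹ = 1 := mul_nonsing_inv _ hu.self_of_nhds
  have h2 : G' * M t * (M t)⁻¹ + (M t)⁻¹ * M' * (M t)⁻¹ = 0 := by
    rw [← add_mul, h0, zero_mul]
  rw [Matrix.mul_assoc G', h1, Matrix.mul_one] at h2
  exact eq_neg_of_add_eq_zero_left h2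

theorem det_smul_deriv_adjugate {M : ℝ → Matrix (Fin n) (Fin n) ℝ}
    {M' S' : Matrix (Fin n) (Fin n) ℝ} {t : ℝ}
    (hM : ∀ i j, HasDerivAt (fun r => M r i j) (M' i j) t)
    (hS : ∀ i j, HasDerivAt (fun r => (M r).adjugate i j) (S' i j) t) :
    (M t).det • S' = ((M t).adjugate * M').trace • (M t).adjugate
      - (M t).adjugate * M' * (M t).adjugate := by
  have h0 : S' * M t + (M t).adjugate * M'
      = ((M t).adjugate * M').trace • (1 : Matrix (Fin n) (Fin n) ℝ) := by
    ext i j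
    refine (hasDerivAt_matrix_mul hS hM i j).unique ?_
    simp only [adjugate_mul, Matrix.smul_apply, smul_eq_mul]
    exact (hasDerivAt_det hM).mul_const _
  have h2 : S' * (M t * (M t).adjugate) + (M t).adjugate * M' * (M t).adjugate
      = ((M t).adjugate * M').trace • (M t).adjugate := by
    rw [← Matrix.mul_assoc, ← add_mul, h0, Matrix.smul_mul, Matrix.one_mul]
  rw [mul_adjugate, Matrix.mul_smul, Matrix.mul_one] at h2
  exact eq_sub_of_add_eq h2

variable {E : Type*} [NormedAddCommGroup E] [NormedSpace ℝ E] {m : WithTop ℕ∞} {V : Set E}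

theorem contDiffOn_det {M : E → Matrix (Fin n) (Fin n) ℝ}
    (h : ∀ i j, ContDiffOn ℝ m (fun x => M x i j) V) : ContDiffOn ℝ m (fun x => (M x).det) V := by
  simp only [det_apply']
  exact ContDiffOn.sum fun σ _ => contDiffOn_const.mul (contDiffOn_prod fun i _ => h _ _)

theorem contDiffOn_adjugate {M : E → Matrix (Fin n) (Fin n) ℝ}
    (h : ∀ i j, ContDiffOn ℝ m (fun x => M x i j) V) (i j : Fin n) :
    ContDiffOn ℝ m (fun x => (M x).adjugate i j) V := by
  simp only [adjugate_apply]
  refine contDiffOn_det fun a b => ?_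
  simp only [updateRow_apply]
  split_ifs
  · exact contDiffOn_const
  · exact h a b

theorem contDiffOn_matrix_inv {M : E → Matrix (Fin n) (Fin n) ℝ}
    (h : ∀ i j, ContDiffOn ℝ m (fun x => M x i j) V) (hu : ∀ x ∈ V, IsUnit (M x).det)
    (i j : Fin n) : ContDiffOn ℝ m (fun x => (M x)⁻¹ i j) V := by
  simp only [inv_def, Matrix.smul_apply, smul_eq_mul, Ring.inverse_eq_inv']
  exact ((contDiffOn_det h).inv fun x hx => (hu x hx).ne_zero).mul (contDiffOn_adjugate h i j)

theorem contDiffOn_matrix_mul {M N : E → Matrix (Fin n) (Fin n) ℝ}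
    (hM : ∀ i j, ContDiffOn ℝ m (fun x => M x i j) V)
    (hN : ∀ i j, ContDiffOn ℝ m (fun x => N x i j) V) (i j : Fin n) :
    ContDiffOn ℝ m (fun x => (M x * N x) i j) V := by
  simp only [mul_apply]
  exact ContDiffOn.sum fun k _ => (hM i k).mul (hN k j)

end MatrixCalculus

noncomputable section Metric

variable {n : ℕ}

theorem hasDerivAt_comp_line {f : (Fin n → ℝ) → ℝ} {x : Fin n → ℝ} (hf : DifferentiableAt ℝ f x)
    (k : Fin n) : HasDerivAt (fun r : ℝ => f (x + r • Pi.single k 1)) (pd k f x) 0 :=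
  hf.hasFDerivAt.hasLineDerivAt _

/-- The entrywise partial derivative of a matrix field. -/
def pdMatrix (M : (Fin n → ℝ) → Matrix (Fin n) (Fin n) ℝ) (k : Fin n) (x : Fin n → ℝ) :
    Matrix (Fin n) (Fin n) ℝ :=
  of fun i j => pd k (fun y => M y i j) x

/-- The matrix `(Γ_k)^i_j = Γ^i_{kj}` of Christoffel symbols with one index fixed. -/
def gammaMatrix (g : (Fin n → ℝ) → Matrix (Fin n) (Fin n) ℝ) (k : Fin n) (x : Fin n → ℝ) :
    Matrix (Fin n) (Fin n) ℝ :=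
  of fun i j => Gamma g i k j x

variable {U : Set (Fin n → ℝ)} {g gbar : (Fin n → ℝ) → Matrix (Fin n) (Fin n) ℝ} {x : Fin n → ℝ}

theorem hasDerivAt_matrix_line {M : (Fin n → ℝ) → Matrix (Fin n) (Fin n) ℝ} (hUo : IsOpen U)
    (hM : ∀ i j, ContDiffOn ℝ (⊤ : ℕ∞) (fun y => M y i j) U) (hx : x ∈ U) (k i j : Fin n) :
    HasDerivAt (fun r : ℝ => M (x + r • Pi.single k 1) i j) (pdMatrix M k x i j) 0 :=
  hasDerivAt_comp_line (((hM i j).contDiffAt (hUo.mem_nhds hx)).differentiableAt (by simp)) k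

theorem eventually_line_mem (hUo : IsOpen U) (hx : x ∈ U) (k : Fin n) :
    ∀ᶠ r : ℝ in nhds 0, x + r • (Pi.single k 1 : Fin n → ℝ) ∈ U := by
  have hc : ContinuousAt (fun r : ℝ => x + r • (Pi.single k 1 : Fin n → ℝ)) 0 := by fun_prop
  exact hc.eventually_mem (hUo.mem_nhds (by simpa using hx))

namespace IsMetricOn

theorem pd_comm (hg : IsMetricOn U g) (hUo : IsOpen U) (hx : x ∈ U) (k i j : Fin n) :
    pd k (fun y => g y i j) x = pd k (fun y => g y j i) x := by
  unfold pd
  rw [Filter.EventuallyEq.fderiv_eq]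
  filter_upwards [hUo.mem_nhds hx] with y hy
  exact (hg.symm y hy).apply j i

theorem Gamma_comm (hg : IsMetricOn U g) (hUo : IsOpen U) (hx : x ∈ U) (k i j : Fin n) :
    Gamma g k i j x = Gamma g k j i x := by
  unfold Gamma
  congr 1
  refine Finset.sum_congr rfl fun l _ => ?_
  rw [hg.pd_comm hUo hx l i j]
  ring

theorem mul_gammaMatrix_apply (hg : IsMetricOn U g) (hx : x ∈ U) (k i j : Fin n) :
    (g x * gammaMatrix g k x) i j = (1 / 2) * (pd k (fun y => g y i j) x
      + pd j (fun y => g y i k) x - pd i (fun y => g y k j) x) := by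
  have h : (gammaMatrix g k x) = (g x)⁻¹ * (of fun l j => (1 / 2) * (pd k (fun y => g y l j) x
      + pd j (fun y => g y l k) x - pd l (fun y => g y k j) x)) := by
    ext i j
    simp only [gammaMatrix, Gamma, of_apply, mul_apply, Finset.mul_sum]
    exact Finset.sum_congr rfl fun l _ => by ring
  rw [h, mul_nonsing_inv_cancel_left _ _ (hg.nondeg x hx)]
  rfl

theorem pdMatrix_eq (hg : IsMetricOn U g) (hUo : IsOpen U) (hx : x ∈ U) (k : Fin n) :
    pdMatrix g k x = g x * gammaMatrix g k x + (gammaMatrix g k x)ᵀ * g x := by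
  have h : (gammaMatrix g k x)ᵀ * g x = (g x * gammaMatrix g k x)ᵀ := by
    rw [transpose_mul, (hg.symm x hx).eq]
  ext i j
  rw [h, Matrix.add_apply, transpose_apply, hg.mul_gammaMatrix_apply hx,
    hg.mul_gammaMatrix_apply hx, hg.pd_comm hUo hx i k j, hg.pd_comm hUo hx k j i,
    hg.pd_comm hUo hx j i k]
  simp only [pdMatrix, of_apply]
  ring

theorem inv_smooth (hg : IsMetricOn U g) (i j : Fin n) :
    ContDiffOn ℝ (⊤ : ℕ∞) (fun y => (g y)⁻¹ i j) U :=
  contDiffOn_matrix_inv hg.smooth hg.nondeg i j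

theorem pdMatrix_inv (hg : IsMetricOn U g) (hUo : IsOpen U) (hx : x ∈ U) (k : Fin n) :
    pdMatrix (fun y => (g y)⁻¹) k x
      = -(gammaMatrix g k x * (g x)⁻¹ + (g x)⁻¹ * (gammaMatrix g k x)ᵀ) := by
  have h := deriv_inv_eq (hasDerivAt_matrix_line hUo hg.smooth hx k)
    (hasDerivAt_matrix_line hUo hg.inv_smooth hx k)
    ((eventually_line_mem hUo hx k).mono fun r hr => hg.nondeg _ hr)
  simp only [zero_smul, add_zero] at h
  rw [h, hg.pdMatrix_eq hUo hx, Matrix.mul_add, Matrix.add_mul,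
    nonsing_inv_mul_cancel_left _ _ (hg.nondeg x hx), Matrix.mul_assoc, Matrix.mul_assoc,
    mul_nonsing_inv _ (hg.nondeg x hx), Matrix.mul_one]

theorem hasDerivAt_log_det (hg : IsMetricOn U g) (hUo : IsOpen U) (hx : x ∈ U) (k : Fin n) :
    HasDerivAt (fun r : ℝ => Real.log (g (x + r • Pi.single k 1)).det)
      (2 * (gammaMatrix g k x).trace) 0 := by
  have h := hasDerivAt_det (hasDerivAt_matrix_line hUo hg.smooth hx k)
  simp only [zero_smul, add_zero] at h
  have hu := hg.nondeg x hx
  have hd := h.log (by simpa using hu.ne_zero)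
  simp only [zero_smul, add_zero] at hd
  convert hd using 1
  rw [eq_div_iff hu.ne_zero, hg.pdMatrix_eq hUo hx, Matrix.mul_add, trace_add, ← Matrix.mul_assoc,
    adjugate_mul, ← Matrix.mul_assoc, trace_mul_comm (_ * _) (g x), ← Matrix.mul_assoc,
    mul_adjugate]
  simp only [Matrix.smul_mul, Matrix.one_mul, trace_smul, trace_transpose, smul_eq_mul]
  ring

end IsMetricOn

/-- The density factor `|det gbar / det g| ^ (1 / (n + 1))`. -/
def detWeight (g gbar : (Fin n → ℝ) → Matrix (Fin n) (Fin n) ℝ) (x : Fin n → ℝ) : ℝ :=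
  |(gbar x).det / (g x).det| ^ ((1 : ℝ) / ((n : ℝ) + 1))

theorem detWeight_eq_exp (hg : IsMetricOn U g) (hgbar : IsMetricOn U gbar) (hx : x ∈ U) :
    detWeight g gbar x
      = Real.exp ((Real.log (gbar x).det - Real.log (g x).det) * (1 / ((n : ℝ) + 1))) := by
  have h1 := (hg.nondeg x hx).ne_zero
  have h2 := (hgbar.nondeg x hx).ne_zero
  rw [detWeight, Real.rpow_def_of_pos (abs_pos.2 (div_ne_zero h2 h1)), Real.log_abs,
    Real.log_div h2 h1]

theorem detWeight_smooth (hg : IsMetricOn U g) (hgbar : IsMetricOn U gbar) :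
    ContDiffOn ℝ (⊤ : ℕ∞) (detWeight g gbar) U := by
  refine ContDiffOn.congr (f := fun x => Real.exp
    ((Real.log (gbar x).det - Real.log (g x).det) * (1 / ((n : ℝ) + 1)))) ?_
    fun x hx => detWeight_eq_exp hg hgbar hx
  exact ((((contDiffOn_det hgbar.smooth).log fun x hx => (hgbar.nondeg x hx).ne_zero).sub
    ((contDiffOn_det hg.smooth).log fun x hx => (hg.nondeg x hx).ne_zero)).mul
      contDiffOn_const).exp

theorem Lfield_eq (g gbar : (Fin n → ℝ) → Matrix (Fin n) (Fin n) ℝ) (x : Fin n → ℝ) :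
    Lfield g gbar x = (detWeight g gbar x • (gbar x)⁻¹) * g x := by
  rw [Lfield, detWeight, Matrix.smul_mul]

theorem weighted_inv_smooth (hg : IsMetricOn U g) (hgbar : IsMetricOn U gbar) (i j : Fin n) :
    ContDiffOn ℝ (⊤ : ℕ∞) (fun y => (detWeight g gbar y • (gbar y)⁻¹) i j) U := by
  simp only [Matrix.smul_apply, smul_eq_mul]
  exact (detWeight_smooth hg hgbar).mul (hgbar.inv_smooth i j)

theorem Lfield_smooth (hg : IsMetricOn U g) (hgbar : IsMetricOn U gbar) (i j : Fin n) :
    ContDiffOn ℝ (⊤ : ℕ∞) (fun y => Lfield g gbar y i j) U := by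
  simp only [Lfield_eq]
  exact contDiffOn_matrix_mul (weighted_inv_smooth hg hgbar) hg.smooth i j

/-- The fundamental equation of projectively equivalent metrics, written for `L`. -/
theorem pdMatrix_Lfield (hg : IsMetricOn U g) (hgbar : IsMetricOn U gbar) (hUo : IsOpen U)
    (hx : x ∈ U) {φ : Fin n → ℝ} (k : Fin n)
    (hφ : gammaMatrix gbar k x
      = gammaMatrix g k x + φ k • 1 + vecMulVec (Pi.single k 1) φ) :
    pdMatrix (Lfield g gbar) k x
      = Lfield g gbar x * gammaMatrix g k x - gammaMatrix g k x * Lfield g gbar x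
        + (vecMulVec (Pi.single k 1) (-(detWeight g gbar x • ((gbar x)⁻¹ *ᵥ φ)))
          + vecMulVec (-(detWeight g gbar x • ((gbar x)⁻¹ *ᵥ φ))) (Pi.single k 1)) * g x := by
  have hn : (n : ℝ) + 1 ≠ 0 := by positivity
  have hw : HasDerivAt (fun r : ℝ => detWeight g gbar (x + r • Pi.single k 1))
      (2 * φ k * detWeight g gbar x) 0 := by
    have h1 := (((hgbar.hasDerivAt_log_det hUo hx k).fun_sub
      (hg.hasDerivAt_log_det hUo hx k)).mul_const (1 / ((n : ℝ) + 1))).exp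
    have h2 : HasDerivAt (fun r : ℝ => detWeight g gbar (x + r • Pi.single k 1)) _ 0 :=
      h1.congr_of_eventuallyEq
      ((eventually_line_mem hUo hx k).mono fun r hr => by
        exact detWeight_eq_exp hg hgbar hr)
    refine h2.congr_deriv ?_
    rw [detWeight_eq_exp hg hgbar hx, hφ, trace_add, trace_add, trace_smul, trace_one,
      trace_vecMulVec, single_one_dotProduct, Fintype.card_fin]
    simp only [zero_smul, add_zero, smul_eq_mul]
    field_simp
    ring
  have hA : pdMatrix (fun y => detWeight g gbar y • (gbar y)⁻¹) k x
      = (2 * φ k * detWeight g gbar x) • (gbar x)⁻¹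
        + detWeight g gbar x • pdMatrix (fun y => (gbar y)⁻¹) k x := by
    ext i j
    refine (hasDerivAt_matrix_line hUo (weighted_inv_smooth hg hgbar) hx k i j).unique ?_
    have h := hw.mul (hasDerivAt_matrix_line hUo hgbar.inv_smooth hx k i j)
    simp only [zero_smul, add_zero] at h
    exact h
  have hsym : ((gbar x)⁻¹)ᵀ = (gbar x)⁻¹ := by
    rw [transpose_nonsing_inv, (hgbar.symm x hx).eq]
  have hL : pdMatrix (Lfield g gbar) k x
      = pdMatrix (fun y => detWeight g gbar y • (gbar y)⁻¹) k x * g x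
        + (detWeight g gbar x • (gbar x)⁻¹) * pdMatrix g k x := by
    ext i j
    refine (hasDerivAt_matrix_line hUo (Lfield_smooth hg hgbar) hx k i j).unique ?_
    simp only [Lfield_eq]
    have h := hasDerivAt_matrix_mul
      (hasDerivAt_matrix_line hUo (weighted_inv_smooth hg hgbar) hx k)
      (hasDerivAt_matrix_line hUo hg.smooth hx k) i j
    simp only [zero_smul, add_zero] at h
    exact h
  have hv : (vecMulVec (Pi.single k 1 : Fin n → ℝ) φ) * (gbar x)⁻¹
      = vecMulVec (Pi.single k 1) ((gbar x)⁻¹ *ᵥ φ) := by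
    rw [vecMulVec_mul, ← mulVec_transpose, hsym]
  have hv' : (gbar x)⁻¹ * (vecMulVec (Pi.single k 1 : Fin n → ℝ) φ)ᵀ
      = vecMulVec ((gbar x)⁻¹ *ᵥ φ) (Pi.single k 1) := by
    rw [transpose_vecMulVec, mul_vecMulVec]
  rw [hL, hA, hgbar.pdMatrix_inv hUo hx, hg.pdMatrix_eq hUo hx, hφ, Lfield_eq]
  simp only [transpose_add, transpose_smul, transpose_one, Matrix.mul_add, Matrix.add_mul, hv, hv',
    Matrix.smul_mul, Matrix.mul_smul, Matrix.one_mul, Matrix.mul_one, smul_add, smul_neg, neg_add,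
    vecMulVec_neg, neg_vecMulVec, vecMulVec_smul, smul_vecMulVec, Matrix.mul_assoc, Matrix.neg_mul]
  module

end Metric

section Resolvent

variable {n : ℕ} {g G A L S T : Matrix (Fin n) (Fin n) ℝ} {s t c d : ℝ}

theorem mul_eq_transpose_mul_of_resolvent (hg : gᵀ = g) (hA : Aᵀ = A) (hL : L = A * g)
    (h₂ : (t • 1 - L) * S = c • 1) (hc : c ≠ 0) :
    g * S = Sᵀ * g := by
  have hM : g * (t • 1 - L) = (t • 1 - L)ᵀ * g := by
    rw [hL]
    simp only [Matrix.mul_sub, transpose_sub, transpose_smul, transpose_one, transpose_mul, hg, hA,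
      Matrix.sub_mul, Matrix.smul_mul, Matrix.mul_smul, Matrix.one_mul, Matrix.mul_one,
      Matrix.mul_assoc]
  have h₂' : Sᵀ * (t • 1 - L)ᵀ = c • 1 := by
    rw [← transpose_mul, h₂, transpose_smul, transpose_one]
  have h : Sᵀ * (g * (t • 1 - L)) * S = Sᵀ * ((t • 1 - L)ᵀ * g) * S := by rw [hM]
  rw [← Matrix.mul_assoc Sᵀ (t • 1 - L)ᵀ, h₂', Matrix.mul_assoc, Matrix.mul_assoc, h₂] at h
  simp only [Matrix.mul_smul, Matrix.smul_mul, Matrix.one_mul, Matrix.mul_one] at h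
  exact (smul_right_injective _ hc h).symm

theorem transpose_eq_of_mul_eq_one (hgt : gᵀ = g) (hgG : g * G = 1) : Gᵀ = G := by
  have h : Gᵀ * g = 1 := by rw [← hgt, ← transpose_mul, hgG, transpose_one]
  calc Gᵀ = Gᵀ * (g * G) := by rw [hgG, Matrix.mul_one]
    _ = G := by rw [← Matrix.mul_assoc, h, Matrix.one_mul]

theorem mul_inv_eq_of_mul_eq (hgG : g * G = 1) (hGg : G * g = 1) (h : g * S = Sᵀ * g) :
    S * G = G * Sᵀ := by
  calc S * G = G * (g * S) * G := by rw [← Matrix.mul_assoc, hGg, Matrix.one_mul]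
    _ = G * Sᵀ := by rw [h, Matrix.mul_assoc, Matrix.mul_assoc, hgG, Matrix.mul_one]

theorem resolvent_sub (h₁ : S * (t • 1 - L) = c • 1) (h₂ : (s • 1 - L) * T = d • 1) :
    (s - t) • (S * T) = d • S - c • T := by
  have e₁ : S * (t • 1 - L) * T = c • T := by rw [h₁, Matrix.smul_mul, Matrix.one_mul]
  have e₂ : S * (s • 1 - L) * T = d • S := by
    rw [Matrix.mul_assoc, h₂, Matrix.mul_smul, Matrix.mul_one]
  rw [← e₁, ← e₂, ← Matrix.sub_mul, ← Matrix.mul_sub, sub_sub_sub_cancel_right, ← sub_smul,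
    Matrix.mul_smul, Matrix.mul_one, Matrix.smul_mul]

theorem mul_comm_of_resolvent (h₁ : S * (t • 1 - L) = c • 1) (h₂ : (t • 1 - L) * S = c • 1) :
    S * L = L * S := by
  have h := h₁.trans h₂.symm
  simpa [Matrix.mul_sub, Matrix.sub_mul] using h

theorem resolvent_comm (hS : S * L = L * S)
    (h₁ : T * (s • 1 - L) = d • 1) (h₂ : (s • 1 - L) * T = d • 1) (hd : d ≠ 0) :
    S * T = T * S := by
  have hM : S * (s • 1 - L) = (s • 1 - L) * S := by
    simp [Matrix.mul_sub, Matrix.sub_mul, hS]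
  have h : T * (S * (s • 1 - L)) * T = T * ((s • 1 - L) * S) * T := by rw [hM]
  rw [← Matrix.mul_assoc T (s • 1 - L), h₁, Matrix.mul_assoc, Matrix.mul_assoc, h₂] at h
  simp only [Matrix.mul_smul, Matrix.smul_mul, Matrix.one_mul, Matrix.mul_one] at h
  exact (smul_right_injective _ hd h).symm

theorem quadratic_deriv_of_resolvent {Γ S' L' : Matrix (Fin n) (Fin n) ℝ} {e ν p : Fin n → ℝ}
    (hgt : gᵀ = g) (hgG : g * G = 1) (hGg : G * g = 1) (hgS : g * S = Sᵀ * g)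
    (h₁ : S * (t • 1 - L) = c • 1) (h₂ : (t • 1 - L) * S = c • 1)
    (hL' : L' = L * Γ - Γ * L + (vecMulVec e ν + vecMulVec ν e) * g)
    (hS' : c • S' = S * L' * S - (S * L').trace • S) :
    c * (p ⬝ᵥ (S' * G + S * -(Γ * G + G * Γᵀ)) *ᵥ p)
      = -2 * c * (p ⬝ᵥ Γ *ᵥ ((S * G) *ᵥ p))
        - 2 * (e ⬝ᵥ Sᵀ *ᵥ (g *ᵥ ν)) * (p ⬝ᵥ (S * G) *ᵥ p)
        + 2 * (e ⬝ᵥ Sᵀ *ᵥ p) * (p ⬝ᵥ S *ᵥ ν) := by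
  set N := (vecMulVec e ν + vecMulVec ν e) * g with hN
  have hSL := mul_comm_of_resolvent h₁ h₂
  have hSG := mul_inv_eq_of_mul_eq hgG hGg hgS
  have hSΓ : S * (L * Γ - Γ * L) * S = c • (S * Γ - Γ * S) := by
    have h : L * Γ - Γ * L = Γ * (t • 1 - L) - (t • 1 - L) * Γ := by
      simp [Matrix.mul_sub, Matrix.sub_mul]
    rw [h, Matrix.mul_sub, Matrix.sub_mul, ← Matrix.mul_assoc S (t • 1 - L), h₁,
      Matrix.mul_assoc S, Matrix.mul_assoc Γ, h₂]
    simp [smul_sub]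
  have htr : (S * L').trace = (S * N).trace := by
    rw [hL', Matrix.mul_add, trace_add, Matrix.mul_sub, trace_sub, ← Matrix.mul_assoc, hSL,
      Matrix.mul_assoc, trace_mul_comm L, Matrix.mul_assoc S Γ L, sub_self, zero_add]
  have hcS' : c • S' = c • (S * Γ - Γ * S) + S * N * S - (S * N).trace • S := by
    rw [hS', htr, hL', Matrix.mul_add, Matrix.add_mul, hSΓ]
  have htrN : (S * N).trace = 2 * (e ⬝ᵥ Sᵀ *ᵥ (g *ᵥ ν)) := by
    have h : (Sᵀ * g) *ᵥ e ⬝ᵥ ν = e ⬝ᵥ (Sᵀ * g) *ᵥ ν := by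
      rw [← hgS, dotProduct_mulVec, ← mulVec_transpose, transpose_mul, hgt, hgS]
    rw [hN, ← Matrix.mul_assoc, trace_mul_comm, ← Matrix.mul_assoc, hgS, Matrix.mul_add, trace_add,
      mul_vecMulVec, mul_vecMulVec, trace_vecMulVec, trace_vecMulVec, h, dotProduct_comm _ e,
      mulVec_mulVec]
    ring
  have hB : c • (S' * G + S * -(Γ * G + G * Γᵀ))
      = -(c • (Γ * (S * G))) - c • (Γ * (S * G))ᵀ + S * N * (S * G) - (S * N).trace • (S * G) := by
    have hGt := transpose_eq_of_mul_eq_one hgt hgG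
    have hBt : (Γ * (S * G))ᵀ = S * (G * Γᵀ) := by
      rw [transpose_mul, transpose_mul, hGt, ← hSG, Matrix.mul_assoc]
    rw [smul_add, ← Matrix.smul_mul, hcS', hBt]
    simp only [Matrix.sub_mul, Matrix.add_mul, Matrix.mul_add, Matrix.mul_neg, Matrix.smul_mul,
      Matrix.mul_assoc]
    module
  have hNq : p ⬝ᵥ (S * N * (S * G)) *ᵥ p = 2 * (e ⬝ᵥ Sᵀ *ᵥ p) * (p ⬝ᵥ S *ᵥ ν) := by
    have h : S * N * (S * G) = S * (vecMulVec e ν + vecMulVec ν e) * Sᵀ := by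
      rw [hN, Matrix.mul_assoc, Matrix.mul_assoc _ g, ← Matrix.mul_assoc g, hgS,
        Matrix.mul_assoc Sᵀ, hgG, Matrix.mul_one, ← Matrix.mul_assoc]
    have hadj : ∀ v w, v ⬝ᵥ S *ᵥ w = w ⬝ᵥ Sᵀ *ᵥ v := fun v w => by
      rw [mulVec_transpose, dotProduct_mulVec, dotProduct_comm]
    rw [h, ← mulVec_mulVec, ← mulVec_mulVec, hadj, add_mulVec, vecMulVec_mulVec, vecMulVec_mulVec,
      hadj]
    simp only [add_dotProduct, smul_dotProduct, op_smul_eq_smul, smul_eq_mul]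
    ring
  have hq : p ⬝ᵥ (Γ * (S * G))ᵀ *ᵥ p = p ⬝ᵥ (Γ * (S * G)) *ᵥ p := by
    rw [mulVec_transpose, dotProduct_comm, dotProduct_mulVec]
  rw [← smul_eq_mul, ← dotProduct_smul, ← smul_mulVec, hB]
  simp only [sub_mulVec, add_mulVec, neg_mulVec, smul_mulVec, dotProduct_sub, dotProduct_add,
    dotProduct_neg, dotProduct_smul, smul_eq_mul, hq, hNq, htrN, mulVec_mulVec]
  ring

theorem bracket_eq_zero_of_resolvent {Γ : Fin n → Matrix (Fin n) (Fin n) ℝ}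
    {ν p Q R : Fin n → ℝ} (hΓ : ∀ i j k, Γ k i j = Γ j i k)
    (hgt : gᵀ = g) (hgG : g * G = 1) (hGg : G * g = 1) (hgS : g * S = Sᵀ * g) (hgT : g * T = Tᵀ * g)
    (h₁ : S * (t • 1 - L) = c • 1) (h₂ : (t • 1 - L) * S = c • 1)
    (h₃ : T * (s • 1 - L) = d • 1) (h₄ : (s • 1 - L) * T = d • 1) (hc : c ≠ 0) (hd : d ≠ 0)
    (hQ : ∀ k, c * Q k = -2 * c * (p ⬝ᵥ Γ k *ᵥ ((S * G) *ᵥ p))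
      - 2 * ((Sᵀ *ᵥ (g *ᵥ ν)) k) * (p ⬝ᵥ (S * G) *ᵥ p) + 2 * ((Sᵀ *ᵥ p) k) * (p ⬝ᵥ S *ᵥ ν))
    (hR : ∀ k, d * R k = -2 * d * (p ⬝ᵥ Γ k *ᵥ ((T * G) *ᵥ p))
      - 2 * ((Tᵀ *ᵥ (g *ᵥ ν)) k) * (p ⬝ᵥ (T * G) *ᵥ p) + 2 * ((Tᵀ *ᵥ p) k) * (p ⬝ᵥ T *ᵥ ν)) :
    ((S * G) *ᵥ p) ⬝ᵥ R - Q ⬝ᵥ ((T * G) *ᵥ p) = 0 := by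
  have hST := resolvent_comm (mul_comm_of_resolvent h₁ h₂) h₃ h₄ hd
  have hsum : ∀ (v Q : Fin n → ℝ) (X : Matrix (Fin n) (Fin n) ℝ) (b : ℝ),
      (∀ k, b * Q k = -2 * b * (p ⬝ᵥ Γ k *ᵥ ((X * G) *ᵥ p))
        - 2 * ((Xᵀ *ᵥ (g *ᵥ ν)) k) * (p ⬝ᵥ (X * G) *ᵥ p) + 2 * ((Xᵀ *ᵥ p) k) * (p ⬝ᵥ X *ᵥ ν)) →
      b * (v ⬝ᵥ Q) = -2 * b * (v ⬝ᵥ fun k => p ⬝ᵥ Γ k *ᵥ ((X * G) *ᵥ p))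
        - 2 * (v ⬝ᵥ Xᵀ *ᵥ (g *ᵥ ν)) * (p ⬝ᵥ (X * G) *ᵥ p)
        + 2 * (v ⬝ᵥ Xᵀ *ᵥ p) * (p ⬝ᵥ X *ᵥ ν) := by
    intro v Q X b hQ
    have h : b • Q = (-2 * b) • (fun k => p ⬝ᵥ Γ k *ᵥ ((X * G) *ᵥ p))
        - (2 * (p ⬝ᵥ (X * G) *ᵥ p)) • (Xᵀ *ᵥ (g *ᵥ ν)) + (2 * (p ⬝ᵥ X *ᵥ ν)) • (Xᵀ *ᵥ p) := by
      ext k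
      simp only [Pi.smul_apply, Pi.sub_apply, Pi.add_apply, smul_eq_mul, hQ]
      ring
    rw [← smul_eq_mul, ← dotProduct_smul, h]
    simp only [dotProduct_add, dotProduct_sub, dotProduct_smul, smul_eq_mul]
    ring
  have hsymm : ∀ v w : Fin n → ℝ,
      (v ⬝ᵥ fun k => p ⬝ᵥ Γ k *ᵥ w) = w ⬝ᵥ fun k => p ⬝ᵥ Γ k *ᵥ v := by
    intro v w
    simp only [dotProduct, mulVec, Finset.mul_sum]
    rw [Finset.sum_comm' (t' := Finset.univ) (s' := fun _ => Finset.univ) (by simp)]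
    conv_rhs => rw [Finset.sum_comm' (t' := Finset.univ) (s' := fun _ => Finset.univ) (by simp)]
    refine Finset.sum_congr rfl fun i _ => ?_
    rw [Finset.sum_comm]
    refine Finset.sum_congr rfl fun j _ => Finset.sum_congr rfl fun k _ => ?_
    rw [hΓ i j k]
    ring
  have hadj : ∀ (X Y : Matrix (Fin n) (Fin n) ℝ) (w : Fin n → ℝ), g * X = Xᵀ * g →
      ((X * G) *ᵥ p) ⬝ᵥ Yᵀ *ᵥ w = p ⬝ᵥ (X * (G * Yᵀ)) *ᵥ w := by
    intro X Y w hX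
    have hXG : (X * G)ᵀ = X * G := by
      rw [transpose_mul, transpose_eq_of_mul_eq_one hgt hgG, mul_inv_eq_of_mul_eq hgG hGg hX]
    rw [← Matrix.mul_assoc, ← mulVec_mulVec w, dotProduct_mulVec p, ← mulVec_transpose, hXG]
  have hSG := mul_inv_eq_of_mul_eq hgG hGg hgS
  have hTG := mul_inv_eq_of_mul_eq hgG hGg hgT
  have e₁ : ((S * G) *ᵥ p) ⬝ᵥ Tᵀ *ᵥ (g *ᵥ ν) = p ⬝ᵥ (S * T) *ᵥ ν := by
    rw [hadj S T _ hgS, ← hTG, mulVec_mulVec, Matrix.mul_assoc, Matrix.mul_assoc, hGg,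
      Matrix.mul_one]
  have e₂ : ((T * G) *ᵥ p) ⬝ᵥ Sᵀ *ᵥ (g *ᵥ ν) = p ⬝ᵥ (S * T) *ᵥ ν := by
    rw [hadj T S _ hgT, ← hSG, mulVec_mulVec, Matrix.mul_assoc, Matrix.mul_assoc, hGg,
      Matrix.mul_one, hST]
  have c₁ : ((S * G) *ᵥ p) ⬝ᵥ Tᵀ *ᵥ p = p ⬝ᵥ (S * T * G) *ᵥ p := by
    rw [hadj S T _ hgS, ← hTG, Matrix.mul_assoc]
  have c₂ : ((T * G) *ᵥ p) ⬝ᵥ Sᵀ *ᵥ p = p ⬝ᵥ (S * T * G) *ᵥ p := by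
    rw [hadj T S _ hgT, ← hSG, hST, Matrix.mul_assoc]
  have hres := resolvent_sub h₁ h₄
  have he : (s - t) * (p ⬝ᵥ (S * T) *ᵥ ν) = d * (p ⬝ᵥ S *ᵥ ν) - c * (p ⬝ᵥ T *ᵥ ν) := by
    rw [← smul_eq_mul, ← dotProduct_smul, ← smul_mulVec, hres]
    simp only [sub_mulVec, smul_mulVec, dotProduct_sub, dotProduct_smul, smul_eq_mul]
  have hcc : (s - t) * (p ⬝ᵥ (S * T * G) *ᵥ p)
      = d * (p ⬝ᵥ (S * G) *ᵥ p) - c * (p ⬝ᵥ (T * G) *ᵥ p) := by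
    rw [← smul_eq_mul, ← dotProduct_smul, ← smul_mulVec, ← Matrix.smul_mul, hres]
    simp only [Matrix.sub_mul, Matrix.smul_mul, sub_mulVec, smul_mulVec, dotProduct_sub,
      dotProduct_smul, smul_eq_mul]
  have hR' := hsum ((S * G) *ᵥ p) R T d hR
  have hQ' := hsum ((T * G) *ᵥ p) Q S c hQ
  rw [e₁, c₁, hsymm] at hR'
  rw [e₂, c₂] at hQ'
  rw [dotProduct_comm Q]
  refine (mul_eq_zero_iff_left (mul_ne_zero hc hd)).1 ?_
  linear_combination c * hR' - d * hQ' + 2 * (p ⬝ᵥ (S * T * G) *ᵥ p) * he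
    - 2 * (p ⬝ᵥ (S * T) *ᵥ ν) * hcc

end Resolvent

section Bracket

variable {n : ℕ} {U : Set (Fin n → ℝ)} {g gbar : (Fin n → ℝ) → Matrix (Fin n) (Fin n) ℝ}
  {x : Fin n → ℝ}

theorem sum_sum_eq_dotProduct_mulVec (B : Matrix (Fin n) (Fin n) ℝ) (p : Fin n → ℝ) :
    ∑ a, ∑ b, p a * B a b * p b = p ⬝ᵥ B *ᵥ p := by
  simp only [dotProduct, mulVec, Finset.mul_sum, mul_assoc]

theorem pd_quadratic_form (B : Matrix (Fin n) (Fin n) ℝ) (p : Fin n → ℝ) (i : Fin n) :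
    pd i (fun p' => ∑ a, ∑ b, p' a * B a b * p' b) p = ((B + Bᵀ) *ᵥ p) i := by
  have hd : DifferentiableAt ℝ (fun p' : Fin n → ℝ => ∑ a, ∑ b, p' a * B a b * p' b) p := by
    fun_prop
  refine (hasDerivAt_comp_line hd i).unique ?_
  have hl : ∀ a, HasDerivAt (fun r : ℝ => (p + r • (Pi.single i 1 : Fin n → ℝ)) a)
      ((Pi.single i 1 : Fin n → ℝ) a) 0 := fun a => by
    simpa using ((hasDerivAt_id (0 : ℝ)).mul_const ((Pi.single i 1 : Fin n → ℝ) a)).const_add (p a)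
  have h := HasDerivAt.fun_sum (u := Finset.univ) fun a _ =>
    HasDerivAt.fun_sum (u := Finset.univ) fun b _ => ((hl a).mul_const (B a b)).fun_mul (hl b)
  refine h.congr_deriv ?_
  simp only [zero_smul, Finset.sum_add_distrib, Matrix.add_mulVec, Pi.add_apply]
  congr 1
  · simp [Pi.single_apply, mulVec, dotProduct]
  · simp [Pi.single_apply, mulVec, dotProduct, mul_comm]

theorem pd_matrix_quadratic (hUo : IsOpen U) {M : (Fin n → ℝ) → Matrix (Fin n) (Fin n) ℝ}
    (hM : ∀ i j, ContDiffOn ℝ (⊤ : ℕ∞) (fun y => M y i j) U) (hx : x ∈ U) (p : Fin n → ℝ)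
    (k : Fin n) :
    pd k (fun y => ∑ a, ∑ b, p a * M y a b * p b) x = p ⬝ᵥ pdMatrix M k x *ᵥ p := by
  rw [← sum_sum_eq_dotProduct_mulVec]
  have hs : ContDiffOn ℝ (⊤ : ℕ∞) (fun y => ∑ a, ∑ b, p a * M y a b * p b) U :=
    ContDiffOn.sum fun a _ => ContDiffOn.sum fun b _ =>
      (contDiffOn_const.mul (hM a b)).mul contDiffOn_const
  refine (hasDerivAt_comp_line ((hs.contDiffAt (hUo.mem_nhds hx)).differentiableAt (by simp))
    k).unique ?_
  exact HasDerivAt.fun_sum fun a _ => HasDerivAt.fun_sum fun b _ =>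
    ((hasDerivAt_matrix_line hUo hM hx k a b).const_mul (p a)).mul_const (p b)

theorem Sfield_smooth (hg : IsMetricOn U g) (hgbar : IsMetricOn U gbar) (i j : Fin n) :
    ContDiffOn ℝ (⊤ : ℕ∞) (fun q : ℝ × (Fin n → ℝ) => Sfield g gbar q.1 q.2 i j)
      (Set.univ ×ˢ U) := by
  refine contDiffOn_adjugate (fun a b => ?_) i j
  simp only [Matrix.sub_apply, Matrix.smul_apply, smul_eq_mul]
  exact (contDiffOn_fst.mul contDiffOn_const).sub
    ((Lfield_smooth hg hgbar a b).comp contDiffOn_snd fun q hq => hq.2)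

theorem Sfield_smooth_right (hg : IsMetricOn U g) (hgbar : IsMetricOn U gbar) (t : ℝ)
    (i j : Fin n) : ContDiffOn ℝ (⊤ : ℕ∞) (fun y => Sfield g gbar t y i j) U := by
  refine contDiffOn_adjugate (fun a b => ?_) i j
  simp only [Matrix.sub_apply]
  exact contDiffOn_const.sub (Lfield_smooth hg hgbar a b)

theorem Sfield_mul_inv_smooth (hg : IsMetricOn U g) (hgbar : IsMetricOn U gbar) (t : ℝ)
    (i j : Fin n) :
    ContDiffOn ℝ (⊤ : ℕ∞) (fun y => (Sfield g gbar t y * (g y)⁻¹) i j) U :=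
  contDiffOn_matrix_mul (Sfield_smooth_right hg hgbar t) hg.inv_smooth i j

theorem continuous_pd_integral (hg : IsMetricOn U g) (hgbar : IsMetricOn U gbar)
    (hUo : IsOpen U) (hx : x ∈ U) (p : Fin n → ℝ) (k : Fin n) :
    Continuous fun t => pd k (fun y => ∑ a, ∑ b,
      p a * (Sfield g gbar t y * (g y)⁻¹) a b * p b) x := by
  set F : ℝ × (Fin n → ℝ) → ℝ := fun q => ∑ a, ∑ b,
      p a * (Sfield g gbar q.1 q.2 * (g q.2)⁻¹) a b * p b with hF
  have hO : IsOpen ((Set.univ : Set ℝ) ×ˢ U) := isOpen_univ.prod hUo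
  have hs : ContDiffOn ℝ (⊤ : ℕ∞) F (Set.univ ×ˢ U) := by
    refine ContDiffOn.sum fun a _ => ContDiffOn.sum fun b _ =>
      (contDiffOn_const.mul (contDiffOn_matrix_mul (Sfield_smooth hg hgbar) (fun i j => ?_)
        a b)).mul contDiffOn_const
    exact (hg.inv_smooth i j).comp contDiffOn_snd fun q hq => hq.2
  have hc := hs.continuousOn_fderiv_of_isOpen hO (by simp)
  have hfd : ∀ t, pd k (fun y => F (t, y)) x = fderiv ℝ F (t, x) (0, Pi.single k 1) := by
    intro t
    have hd : DifferentiableAt ℝ F (t, x) :=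
      (hs.contDiffAt (hO.mem_nhds ⟨Set.mem_univ _, hx⟩)).differentiableAt (by simp)
    have h := hd.hasFDerivAt.comp x (hasFDerivAt_prodMk_right t x)
    have h' : HasFDerivAt (fun y => F (t, y)) _ x := h
    rw [pd, h'.fderiv]
    rfl
  change Continuous fun t => pd k (fun y => F (t, y)) x
  simp only [hfd]
  have hc' : Continuous fun t : ℝ => fderiv ℝ F (t, x) :=
    hc.comp_continuous (by fun_prop) fun t => ⟨Set.mem_univ _, hx⟩
  exact hc'.clm_apply continuous_const

theorem dense_det_smul_one_sub_ne_zero (L : Matrix (Fin n) (Fin n) ℝ) :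
    Dense {t : ℝ | (t • (1 : Matrix (Fin n) (Fin n) ℝ) - L).det ≠ 0} := by
  have hfin : {t : ℝ | (t • (1 : Matrix (Fin n) (Fin n) ℝ) - L).det = 0}.Finite := by
    refine (Polynomial.finite_setOfPred_isRoot L.charpoly_monic.ne_zero).subset fun t ht => ?_
    rw [Set.mem_ofPred_eq, Polynomial.IsRoot, Matrix.eval_charpoly, scalar_apply,
      ← smul_one_eq_diagonal]
    exact ht
  exact hfin.countable.dense_compl ℝ

theorem bracket_eq_zero_of_Gamma (hg : IsMetricOn U g) (hgbar : IsMetricOn U gbar)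
    (hUo : IsOpen U) (hx : x ∈ U) {φ : Fin n → ℝ}
    (hφ : ∀ k, gammaMatrix gbar k x
      = gammaMatrix g k x + φ k • 1 + vecMulVec (Pi.single k 1) φ) (p : Fin n → ℝ) (t s : ℝ) :
    ∑ i, (pd i (fun p' => ∑ a, ∑ b, p' a * (Sfield g gbar t x * (g x)⁻¹) a b * p' b) p *
            pd i (fun x' => ∑ a, ∑ b, p a * (Sfield g gbar s x' * (g x')⁻¹) a b * p b) x -
          pd i (fun x' => ∑ a, ∑ b, p a * (Sfield g gbar t x' * (g x')⁻¹) a b * p b) x *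
            pd i (fun p' => ∑ a, ∑ b, p' a * (Sfield g gbar s x * (g x)⁻¹) a b * p' b) p)
      = 0 := by
  have hu := hg.nondeg x hx
  have hgt : (g x)ᵀ = g x := hg.symm x hx
  have hgG : g x * (g x)⁻¹ = 1 := mul_nonsing_inv _ hu
  have hGg : (g x)⁻¹ * g x = 1 := nonsing_inv_mul _ hu
  have hA : (detWeight g gbar x • (gbar x)⁻¹)ᵀ = detWeight g gbar x • (gbar x)⁻¹ := by
    rw [transpose_smul, transpose_nonsing_inv, (hgbar.symm x hx).eq]
  have h₁ : ∀ t, Sfield g gbar t x * (t • 1 - Lfield g gbar x)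
      = (t • 1 - Lfield g gbar x).det • 1 := fun t => adjugate_mul _
  have h₂ : ∀ t, (t • 1 - Lfield g gbar x) * Sfield g gbar t x
      = (t • 1 - Lfield g gbar x).det • 1 := fun t => mul_adjugate _
  have hgS : ∀ t, (t • 1 - Lfield g gbar x).det ≠ 0 →
      g x * Sfield g gbar t x = (Sfield g gbar t x)ᵀ * g x := fun t ht =>
    mul_eq_transpose_mul_of_resolvent hgt hA (Lfield_eq g gbar x) (h₂ t) ht
  set ν := -(detWeight g gbar x • ((gbar x)⁻¹ *ᵥ φ)) with hν
  have hderiv : ∀ t, (t • 1 - Lfield g gbar x).det ≠ 0 → ∀ k,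
      (t • 1 - Lfield g gbar x).det *
        pd k (fun y => ∑ a, ∑ b, p a * (Sfield g gbar t y * (g y)⁻¹) a b * p b) x
      = -2 * (t • 1 - Lfield g gbar x).det
          * (p ⬝ᵥ gammaMatrix g k x *ᵥ ((Sfield g gbar t x * (g x)⁻¹) *ᵥ p))
        - 2 * (((Sfield g gbar t x)ᵀ *ᵥ (g x *ᵥ ν)) k)
          * (p ⬝ᵥ (Sfield g gbar t x * (g x)⁻¹) *ᵥ p)
        + 2 * (((Sfield g gbar t x)ᵀ *ᵥ p) k) * (p ⬝ᵥ Sfield g gbar t x *ᵥ ν) := by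
    intro t ht k
    have hL' := pdMatrix_Lfield hg hgbar hUo hx k (hφ k)
    have hS' : (t • 1 - Lfield g gbar x).det • pdMatrix (Sfield g gbar t) k x
        = Sfield g gbar t x * pdMatrix (Lfield g gbar) k x * Sfield g gbar t x
          - (Sfield g gbar t x * pdMatrix (Lfield g gbar) k x).trace • Sfield g gbar t x := by
      have hM : ∀ i j, HasDerivAt (fun r : ℝ => (t • (1 : Matrix (Fin n) (Fin n) ℝ)
          - Lfield g gbar (x + r • Pi.single k 1)) i j)
          ((-pdMatrix (Lfield g gbar) k x) i j) 0 := fun i j =>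
        (hasDerivAt_matrix_line hUo (Lfield_smooth hg hgbar) hx k i j).const_sub _
      have h := det_smul_deriv_adjugate hM
        (hasDerivAt_matrix_line hUo (Sfield_smooth_right hg hgbar t) hx k)
      simp only [zero_smul, add_zero, Matrix.mul_neg, Matrix.neg_mul, trace_neg, neg_smul,
        sub_neg_eq_add] at h
      rw [h, neg_add_eq_sub]
      rfl
    have hB' : pdMatrix (fun y => Sfield g gbar t y * (g y)⁻¹) k x
        = pdMatrix (Sfield g gbar t) k x * (g x)⁻¹ + Sfield g gbar t x *
          -(gammaMatrix g k x * (g x)⁻¹ + (g x)⁻¹ * (gammaMatrix g k x)ᵀ) := by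
      ext i j
      refine (hasDerivAt_matrix_line hUo (Sfield_mul_inv_smooth hg hgbar t) hx k i j).unique ?_
      have h := hasDerivAt_matrix_mul
        (hasDerivAt_matrix_line hUo (Sfield_smooth_right hg hgbar t) hx k)
        (hasDerivAt_matrix_line hUo hg.inv_smooth hx k) i j
      simp only [zero_smul, add_zero] at h
      rw [← hg.pdMatrix_inv hUo hx]
      exact h
    rw [pd_matrix_quadratic hUo (Sfield_mul_inv_smooth hg hgbar t) hx, hB',
      quadratic_deriv_of_resolvent hgt hgG hGg (hgS t ht) (h₁ t) (h₂ t) hL' hS']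
    simp only [single_one_dotProduct, hν]
  have hsymm : ∀ t, (t • 1 - Lfield g gbar x).det ≠ 0 →
      (Sfield g gbar t x * (g x)⁻¹)ᵀ = Sfield g gbar t x * (g x)⁻¹ := by
    intro t ht
    rw [transpose_mul, transpose_eq_of_mul_eq_one hgt hgG,
      mul_inv_eq_of_mul_eq hgG hGg (hgS t ht)]
  have hgen : ∀ t, (t • 1 - Lfield g gbar x).det ≠ 0 → ∀ s,
      (s • 1 - Lfield g gbar x).det ≠ 0 →
      ∑ i, (pd i (fun p' => ∑ a, ∑ b, p' a * (Sfield g gbar t x * (g x)⁻¹) a b * p' b) p *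
            pd i (fun x' => ∑ a, ∑ b, p a * (Sfield g gbar s x' * (g x')⁻¹) a b * p b) x -
          pd i (fun x' => ∑ a, ∑ b, p a * (Sfield g gbar t x' * (g x')⁻¹) a b * p b) x *
            pd i (fun p' => ∑ a, ∑ b, p' a * (Sfield g gbar s x * (g x)⁻¹) a b * p' b) p)
      = 0 := by
    intro t ht s hs
    have h := bracket_eq_zero_of_resolvent (Γ := fun k => gammaMatrix g k x)
      (fun i j k => hg.Gamma_comm hUo hx i k j) hgt hgG hGg (hgS t ht) (hgS s hs)
      (h₁ t) (h₂ t) (h₁ s) (h₂ s) ht hs (hderiv t ht) (hderiv s hs)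
    simp only [pd_quadratic_form, hsymm t ht, hsymm s hs, ← two_smul ℝ (_ * _), smul_mulVec,
      Pi.smul_apply, smul_eq_mul]
    simp only [dotProduct, ← Finset.sum_sub_distrib] at h
    rw [← mul_zero (2 : ℝ), ← h, Finset.mul_sum]
    exact Finset.sum_congr rfl fun i _ => by ring
  have hP : ∀ i, Continuous fun t =>
      pd i (fun p' => ∑ a, ∑ b, p' a * (Sfield g gbar t x * (g x)⁻¹) a b * p' b) p := by
    intro i
    have hS : Continuous fun t => Sfield g gbar t x := by
      unfold Sfield
      fun_prop
    simp only [pd_quadratic_form]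
    fun_prop
  have hQ := continuous_pd_integral hg hgbar hUo hx p
  have hdense := dense_det_smul_one_sub_ne_zero (Lfield g gbar x)
  have hleft : ∀ s, (s • 1 - Lfield g gbar x).det ≠ 0 → ∀ t,
      ∑ i, (pd i (fun p' => ∑ a, ∑ b, p' a * (Sfield g gbar t x * (g x)⁻¹) a b * p' b) p *
            pd i (fun x' => ∑ a, ∑ b, p a * (Sfield g gbar s x' * (g x')⁻¹) a b * p b) x -
          pd i (fun x' => ∑ a, ∑ b, p a * (Sfield g gbar t x' * (g x')⁻¹) a b * p b) x *
            pd i (fun p' => ∑ a, ∑ b, p' a * (Sfield g gbar s x * (g x)⁻¹) a b * p' b) p)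
      = 0 := fun s hs => congrFun <| Continuous.ext_on hdense
    (continuous_finsetSum _ fun i _ =>
      ((hP i).mul continuous_const).sub ((hQ i).mul continuous_const))
    continuous_const fun t ht => hgen t ht s hs
  exact congrFun (Continuous.ext_on hdense
    (continuous_finsetSum _ fun i _ =>
      (continuous_const.mul (hQ i)).sub (continuous_const.mul (hP i)))
    continuous_const fun s hs => hleft s hs t) s

end Bracket

section Geodesics

variable {n : ℕ} {U : Set (Fin n → ℝ)} {g gbar : (Fin n → ℝ) → Matrix (Fin n) (Fin n) ℝ}
  {x : Fin n → ℝ}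

theorem contDiffOn_of_hasDerivAt_comp {E : Type*} [NormedAddCommGroup E] [NormedSpace ℝ E]
    {F : E → E} {V : Set E} {α : ℝ → E} {I : Set ℝ} (hF : ContDiffOn ℝ (⊤ : ℕ∞) F V)
    (hI : IsOpen I) (hα : ∀ t ∈ I, HasDerivAt α (F (α t)) t) (hV : Set.MapsTo α I V) :
    ContDiffOn ℝ (⊤ : ℕ∞) α I := by
  rw [contDiffOn_infty]
  intro m
  induction m with
  | zero =>
    simp only [Nat.cast_zero, contDiffOn_zero]
    exact fun t ht => (hα t ht).continuousAt.continuousWithinAt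
  | succ m ih =>
    push_cast
    rw [contDiffOn_succ_iff_deriv_of_isOpen hI]
    refine ⟨fun t ht => (hα t ht).differentiableAt.differentiableWithinAt, by simp, ?_⟩
    exact ((contDiffOn_infty.1 hF m).comp ih hV).congr fun t ht => (hα t ht).deriv

theorem IsMetricOn.Gamma_smooth (hg : IsMetricOn U g) (hUo : IsOpen U) (k i j : Fin n) :
    ContDiffOn ℝ (⊤ : ℕ∞) (Gamma g k i j) U := by
  have hpd : ∀ k i j, ContDiffOn ℝ (⊤ : ℕ∞) (pd k fun y => g y i j) U := fun k i j =>
    ((hg.smooth i j).fderiv_of_isOpen hUo (by simp)).clm_apply contDiffOn_const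
  exact contDiffOn_const.mul (ContDiffOn.sum fun l _ =>
    (hg.inv_smooth k l).mul (((hpd _ _ _).add (hpd _ _ _)).sub (hpd _ _ _)))

theorem IsMetricOn.exists_geodesic (hg : IsMetricOn U g) (hUo : IsOpen U) (hx : x ∈ U)
    {v : Fin n → ℝ} (hv : v ≠ 0) :
    ∃ (γ : ℝ → Fin n → ℝ) (I : Set ℝ), IsGeodesicOn U g γ I ∧
      (∀ t ∈ I, ∃ k, deriv (fun s => γ s k) t ≠ 0) ∧ (0 : ℝ) ∈ I ∧ γ 0 = x ∧
      ∀ k, deriv (fun s => γ s k) 0 = v k := by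
  set F : (Fin n → ℝ) × (Fin n → ℝ) → (Fin n → ℝ) × (Fin n → ℝ) := fun q =>
    (q.2, fun k => -∑ i, ∑ j, Gamma g k i j q.1 * q.2 i * q.2 j) with hFdef
  set V : Set ((Fin n → ℝ) × (Fin n → ℝ)) := U ×ˢ {v | v ≠ 0} with hVdef
  have hVo : IsOpen V := hUo.prod isOpen_ne
  have hF : ContDiffOn ℝ (⊤ : ℕ∞) F V := by
    have hc : ∀ i, ContDiffOn ℝ (⊤ : ℕ∞)
        (fun q : (Fin n → ℝ) × (Fin n → ℝ) => q.2 i) V := fun i =>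
      ((contDiff_apply ℝ ℝ i).comp contDiff_snd).contDiffOn
    refine contDiffOn_snd.prodMk (contDiffOn_pi.2 fun k => ?_)
    refine (ContDiffOn.sum fun i _ => ContDiffOn.sum fun j _ => ?_).neg
    exact (((hg.Gamma_smooth hUo k i j).comp contDiffOn_fst fun q hq => hq.1).mul (hc i)).mul (hc j)
  have hmem : ((x, v) : (Fin n → ℝ) × (Fin n → ℝ)) ∈ V := ⟨hx, hv⟩
  have hF1 : ContDiffAt ℝ 1 F (x, v) := (hF.contDiffAt (hVo.mem_nhds hmem)).of_le (by simp)
  obtain ⟨α, hα0, ε, hε, hα⟩ :=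
    hF1.exists_forall_mem_closedBall_exists_eq_forall_mem_Ioo_hasDerivAt₀ 0
  have hcont : ContinuousAt α 0 := (hα 0 (by simp [hε])).continuousAt
  obtain ⟨δ, hδ, hball⟩ := Metric.eventually_nhds_iff_ball.1
    (hcont.eventually_mem (hVo.mem_nhds (by rwa [hα0])))
  set I : Set ℝ := Set.Ioo (-min ε δ) (min ε δ) with hI
  have hIα : ∀ t ∈ I, HasDerivAt α (F (α t)) t := fun t ht => hα t
    ⟨by linarith [ht.1, min_le_left ε δ], by linarith [ht.2, min_le_left ε δ]⟩
  have hIV : Set.MapsTo α I V := fun t ht => hball t <| by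
    rw [Real.ball_eq_Ioo]
    exact ⟨by linarith [ht.1, min_le_right ε δ], by linarith [ht.2, min_le_right ε δ]⟩
  have hIo : IsOpen I := isOpen_Ioo
  have h0 : (0 : ℝ) ∈ I := by simp [hI, hε, hδ]
  have hsm := contDiffOn_of_hasDerivAt_comp hF hIo hIα hIV
  have hd1 : ∀ t ∈ I, ∀ k, HasDerivAt (fun s => (α s).1 k) ((α t).2 k) t := fun t ht k =>
    hasDerivAt_pi.1 (hIα t ht).fst k
  have hd2 : ∀ t ∈ I, ∀ k, HasDerivAt (fun s => (α s).2 k) ((F (α t)).2 k) t := fun t ht k =>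
    hasDerivAt_pi.1 (hIα t ht).snd k
  refine ⟨fun t => (α t).1, I, ⟨⟨hIo, Set.ordConnected_Ioo⟩, fun k => ?_, fun t ht => (hIV ht).1,
    fun t ht k => ?_⟩, fun t ht => ?_, h0, by simp [hα0], fun k => ?_⟩
  · exact contDiffOn_pi.1 (contDiff_fst.comp_contDiffOn hsm) k
  · have hev : deriv (fun s => (α s).1 k) =ᶠ[nhds t] fun s => (α s).2 k := by
      filter_upwards [hIo.mem_nhds ht] with r hr
      exact (hd1 r hr k).deriv
    rw [hev.deriv_eq, (hd2 t ht k).deriv]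
    simp only [(hd1 t ht _).deriv, hFdef]
    exact neg_add_cancel _
  · obtain ⟨k, hk⟩ := Function.ne_iff.1 (hIV ht).2
    exact ⟨k, by rw [(hd1 t ht k).deriv]; exact hk⟩
  · rw [(hd1 0 h0 k).deriv, hα0]

theorem ProjEquiv.exists_Gamma_sub_eq (hproj : ProjEquiv U g gbar) (hg : IsMetricOn U g)
    (hUo : IsOpen U) (hx : x ∈ U) {v : Fin n → ℝ} (hv : v ≠ 0) :
    ∃ c : ℝ, ∀ k, ∑ i, ∑ j, (Gamma gbar k i j x - Gamma g k i j x) * v i * v j = c * v k := by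
  obtain ⟨γ, I, hγ, hne, h0, hγ0, hγv⟩ := hg.exists_geodesic hUo hx hv
  obtain ⟨φ, J, hJ, hφ, -, hφJ, hφ', hbar⟩ := hproj γ I hγ hne
  obtain ⟨τ, hτ, hτ0⟩ : ∃ τ ∈ J, φ τ = 0 := by
    rw [← hφJ] at h0
    exact h0
  have hIo := hγ.interval.1
  have hdφ : ∀ t ∈ J, HasDerivAt φ (deriv φ t) t := fun t ht =>
    ((hφ.contDiffAt (hJ.1.mem_nhds ht)).differentiableAt (by simp)).hasDerivAt
  have hddφ : HasDerivAt (deriv φ) (deriv (deriv φ) τ) τ :=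
    ((((contDiffOn_infty_iff_deriv_of_isOpen hJ.1).1 hφ).2.contDiffAt
      (hJ.1.mem_nhds hτ)).differentiableAt (by simp)).hasDerivAt
  have hdγ : ∀ t ∈ I, ∀ k, HasDerivAt (fun s => γ s k) (deriv (fun s => γ s k) t) t :=
    fun t ht k =>
      (((hγ.smooth k).contDiffAt (hIo.mem_nhds ht)).differentiableAt (by simp)).hasDerivAt
  have hddγ : ∀ k, HasDerivAt (deriv fun s => γ s k) (deriv (deriv fun s => γ s k) 0) 0 :=
    fun k => ((((contDiffOn_infty_iff_deriv_of_isOpen hIo).1 (hγ.smooth k)).2.contDiffAt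
      (hIo.mem_nhds h0)).differentiableAt (by simp)).hasDerivAt
  have hd : ∀ k, ∀ t ∈ J, HasDerivAt (fun s => (γ ∘ φ) s k)
      (deriv (fun s => γ s k) (φ t) * deriv φ t) t := fun k t ht =>
    (hdγ (φ t) (hφJ ▸ Set.mem_image_of_mem φ ht) k).comp t (hdφ t ht)
  have hdd : ∀ k, deriv (deriv fun s => (γ ∘ φ) s k) τ
      = deriv (deriv fun s => γ s k) 0 * deriv φ τ * deriv φ τ + v k * deriv (deriv φ) τ := by
    intro k
    have hev : deriv (fun s => (γ ∘ φ) s k)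
        =ᶠ[nhds τ] fun t => deriv (fun s => γ s k) (φ t) * deriv φ t := by
      filter_upwards [hJ.1.mem_nhds hτ] with t ht
      exact (hd k t ht).deriv
    have h1 : HasDerivAt (fun t => deriv (fun s => γ s k) (φ t))
        (deriv (deriv fun s => γ s k) 0 * deriv φ τ) τ := by
      have := hddγ k
      rw [← hτ0] at this ⊢
      exact this.comp τ (hdφ τ hτ)
    rw [hev.deriv_eq, (h1.fun_mul hddφ).deriv, hτ0, hγv]
  have hφτ := hφ' τ hτ
  refine ⟨-deriv (deriv φ) τ / (deriv φ τ * deriv φ τ), fun k => ?_⟩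
  have e1 := hγ.eqn 0 h0 k
  have e2 := hbar.eqn τ hτ k
  have hx' : (γ ∘ φ) τ = x := by rw [Function.comp_apply, hτ0, hγ0]
  rw [hdd, hx'] at e2
  simp only [(hd _ τ hτ).deriv, hτ0, hγv] at e2
  simp only [hγ0, hγv] at e1
  have e3 : ∑ i, ∑ j, Gamma gbar k i j x * (v i * deriv φ τ) * (v j * deriv φ τ)
      = (deriv φ τ * deriv φ τ) * ∑ i, ∑ j, Gamma gbar k i j x * v i * v j := by
    simp only [Finset.mul_sum]
    exact Finset.sum_congr rfl fun i _ => Finset.sum_congr rfl fun j _ => by ring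
  rw [e3] at e2
  simp only [sub_mul, Finset.sum_sub_distrib]
  rw [div_mul_eq_mul_div, eq_div_iff (mul_ne_zero hφτ hφτ)]
  linear_combination e2 - (deriv φ τ * deriv φ τ) * e1

/-- A symmetric bilinear map whose diagonal values are proportional to the argument is a
symmetrized product with a covector. -/
theorem exists_covector_of_diagonal_proportional {P : Fin n → Fin n → Fin n → ℝ}
    (hP : ∀ k i j, P k i j = P k j i)
    (h : ∀ v : Fin n → ℝ, v ≠ 0 → ∃ c : ℝ, ∀ k, ∑ i, ∑ j, P k i j * v i * v j = c * v k) :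
    ∃ φ : Fin n → ℝ, ∀ k i j,
      P k i j = φ i * (if k = j then 1 else 0) + (if k = i then 1 else 0) * φ j := by
  have h1 : ∀ k i, k ≠ i → P k i i = 0 := by
    intro k i hki
    obtain ⟨c, hc⟩ := h (Pi.single i 1) (by simp)
    simpa [Pi.single_apply, hki] using hc k
  have h2 : ∀ i j, i ≠ j → ∀ r : ℝ, ∃ c : ℝ, ∀ k,
      P k i i + 2 * r * P k i j + r * r * P k j j
        = c * ((if k = i then 1 else 0) + r * (if k = j then 1 else 0)) := by
    intro i j hij r
    obtain ⟨c, hc⟩ := h (Pi.single i 1 + r • Pi.single j 1) (Function.ne_iff.2 ⟨i, by simp [hij]⟩)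
    refine ⟨c, fun k => ?_⟩
    have hk := hc k
    simp only [Pi.add_apply, Pi.smul_apply, Pi.single_apply, smul_eq_mul, mul_add, mul_ite, mul_one,
      mul_zero, add_mul, ite_mul, zero_mul, Finset.sum_add_distrib, Finset.sum_ite_eq',
      Finset.mem_univ, if_true] at hk
    simp only [mul_add, mul_ite, mul_one, mul_zero]
    rw [hP k j i] at hk
    linear_combination hk
  have h3 : ∀ i j k, i ≠ j → k ≠ i → k ≠ j → P k i j = 0 := by
    intro i j k hij hki hkj
    obtain ⟨c, hc⟩ := h2 i j hij 1
    have hk := hc k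
    rw [h1 k i hki, h1 k j hkj] at hk
    simp only [hki, hkj, if_false] at hk
    linarith
  have h4 : ∀ i j, i ≠ j → P i i i = 2 * P j i j := by
    intro i j hij
    obtain ⟨c, hc⟩ := h2 i j hij 1
    obtain ⟨c', hc'⟩ := h2 i j hij (-1)
    have e1 := hc i
    have e2 := hc j
    have e3 := hc' i
    have e4 := hc' j
    simp only [hij, hij.symm, if_false, if_true, h1 i j hij, h1 j i hij.symm] at e1 e2 e3 e4
    linarith
  refine ⟨fun i => P i i i / 2, fun k i j => ?_⟩
  rcases eq_or_ne i j with rfl | hij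
  · rcases eq_or_ne k i with rfl | hki
    · simp
    · simp [hki, h1 k i hki]
  · rcases eq_or_ne k i with rfl | hki
    · simp [hij, hP k k j, h4 j k hij.symm]
    · rcases eq_or_ne k j with rfl | hkj
      · simp [hki, h4 i k hij]
      · simp [hki, hkj, h3 i j k hij hki hkj]

theorem ProjEquiv.exists_gammaMatrix_eq (hproj : ProjEquiv U g gbar) (hg : IsMetricOn U g)
    (hgbar : IsMetricOn U gbar) (hUo : IsOpen U) (hx : x ∈ U) :
    ∃ φ : Fin n → ℝ, ∀ k, gammaMatrix gbar k x
      = gammaMatrix g k x + φ k • 1 + vecMulVec (Pi.single k 1) φ := by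
  obtain ⟨φ, hφ⟩ := exists_covector_of_diagonal_proportional
    (P := fun k i j => Gamma gbar k i j x - Gamma g k i j x)
    (fun k i j => by rw [hgbar.Gamma_comm hUo hx, hg.Gamma_comm hUo hx])
    (fun v hv => hproj.exists_Gamma_sub_eq hg hUo hx hv)
  refine ⟨φ, fun k => ?_⟩
  ext i j
  have h := hφ i k j
  simp only [gammaMatrix, of_apply, Matrix.add_apply, Matrix.smul_apply, one_apply, vecMulVec_apply,
    Pi.single_apply, smul_eq_mul]
  linear_combination h

end Geodesics

theorem integrals_Poisson_commute {n : ℕ} (hn : 2 ≤ n) (U : Set (Fin n → ℝ)) (hUo : IsOpen U) (hUc : IsConnected U)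
    (g gbar : (Fin n → ℝ) → Matrix (Fin n) (Fin n) ℝ)
    (hg : IsMetricOn U g) (hgbar : IsMetricOn U gbar)
    (hproj : ProjEquiv U g gbar) (t s : ℝ) :
    ∀ x ∈ U, ∀ p : Fin n → ℝ,
      ∑ i, (pd i (fun p' => ∑ a, ∑ b, p' a * (Sfield g gbar t x * (g x)⁻¹) a b * p' b) p *
              pd i (fun x' => ∑ a, ∑ b, p a * (Sfield g gbar s x' * (g x')⁻¹) a b * p b) x -
            pd i (fun x' => ∑ a, ∑ b, p a * (Sfield g gbar t x' * (g x')⁻¹) a b * p b) x *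
              pd i (fun p' => ∑ a, ∑ b, p' a * (Sfield g gbar s x * (g x)⁻¹) a b * p' b) p)
        = 0 := by
  intro x hx p
  obtain ⟨φ, hφ⟩ := hproj.exists_gammaMatrix_eq hg hgbar hUo hx
  exact bracket_eq_zero_of_Gamma hg hgbar hUo hx hφ p t s
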